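/- arXiv:2502.14941 — 12 statements merged into one kernel-verified Lean document; each statement's English description precedes it below -/
import Mathlib

section
/- Let (T, μ, η) be a monad on a category C, let S be an object of C, and let (A, e) be a T-algebra. Then the partial evaluation relation on the hom-set C(S, TA) is reflexive; and if moreover the multiplication μ is weakly cartesian, the partial evaluation relation is transitive. -/
open CategoryTheory

universe v u

/-- A commutative square `f ≫ m = g ≫ n` is a weak pullback if every cone over the
cospan factors (not necessarily uniquely) through it. -/
def IsWeakPullback {C : Type u} [Category.{v} C] {A B D E : C}
    (f : A ⟶ B) (g : A ⟶ D) (m : B ⟶ E) (n : D ⟶ E) : Prop :=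
  f ≫ m = g ≫ n ∧
    ∀ (S : C) (p : S ⟶ D) (q : S ⟶ B), q ≫ m = p ≫ n →
      ∃ r : S ⟶ A, r ≫ f = q ∧ r ≫ g = p

/-- The partial evaluation relation on `C(S, TA)` for a `T`-algebra `(A, a)`:
`p` partially evaluates to `q` iff there is `k : S ⟶ TTA` with `μ ∘ k = p` and
`T a ∘ k = q`. -/
def PartialEvalRel {C : Type u} [Category.{v} C] (T : Monad C) (S : C)
    (alg : Monad.Algebra T) (p q : S ⟶ T.obj alg.A) : Prop :=
  ∃ k : S ⟶ T.obj (T.obj alg.A), k ≫ T.μ.app alg.A = p ∧ k ≫ T.map alg.a = q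

/-- The partial evaluation relation on `C(S, TA)` is reflexive, and if the multiplication
`μ` of the monad is weakly cartesian, it is also transitive. -/
theorem partialEvalRel_reflexive_and_transitive_of_weaklyCartesian_mu
    {C : Type u} [Category.{v} C] (T : Monad C) (S : C) (alg : Monad.Algebra T) :
    Reflexive (PartialEvalRel T S alg) ∧
      ((∀ (X Y : C) (f : X ⟶ Y),
          IsWeakPullback (T.map (T.map f)) (T.μ.app X) (T.μ.app Y) (T.map f)) →
        Transitive (PartialEvalRel T S alg)) := by
  refine ⟨fun p => ⟨p ≫ T.map (T.η.app alg.A), ?_, ?_⟩, ?_⟩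
  · rw [Category.assoc, T.right_unit]
    exact Category.comp_id p
  · rw [Category.assoc, ← T.map_comp, alg.unit, T.map_id, Category.comp_id]
  · rintro hμ p q r ⟨k, hkp, hkq⟩ ⟨l, hlq, hlr⟩
    obtain ⟨t, htl, htk⟩ := (hμ _ _ alg.a).2 S k l (hlq.trans hkq.symm)
    refine ⟨t ≫ T.map (T.μ.app alg.A), ?_, ?_⟩
    · rw [Category.assoc, T.assoc, reassoc_of% htk, hkp]
    · rw [Category.assoc, ← T.map_comp, alg.assoc, T.map_comp, reassoc_of% htl, hlr]
end

section
/- Let (T, μ, η) be a monad on a category C, let C_T be its Kleisli category, and let R: C_T → C be the right adjoint of the Kleisli adjunction (on objects R A = T A, and R sends a Kleisli morphism f: A → B, i.e. a morphism f: A → TB of C, to μ_B ∘ T f: TA → TB). Then a commutative square in C_T is a weak pullback in C_T if and only if its image under R is a weak pullback in C. -/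
open CategoryTheory

universe v u

namespace IsWeakPullback

universe v' u'

variable {C : Type u} [Category.{v} C] {K : Type u'} [Category.{v'} K]
  {L : C ⥤ K} {R : K ⥤ C} {A B D E : K} {f : A ⟶ B} {g : A ⟶ D} {m : B ⟶ E} {n : D ⟶ E}

/-- Right adjoints preserve weak pullbacks. -/
theorem map_of_adjunction (adj : L ⊣ R) (h : IsWeakPullback f g m n) :
    IsWeakPullback (R.map f) (R.map g) (R.map m) (R.map n) := by
  refine ⟨by rw [← R.map_comp, h.1, R.map_comp], fun S p q hpq => ?_⟩
  obtain ⟨r, hf, hg⟩ := h.2 (L.obj S) ((adj.homEquiv S D).symm p) ((adj.homEquiv S B).symm q)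
    (by rw [← adj.homEquiv_naturality_right_symm, hpq, adj.homEquiv_naturality_right_symm])
  refine ⟨adj.homEquiv S A r, ?_, ?_⟩
  · rw [← adj.homEquiv_naturality_right, hf, Equiv.apply_symm_apply]
  · rw [← adj.homEquiv_naturality_right, hg, Equiv.apply_symm_apply]

/-- A right adjoint reflects weak pullbacks among commutative squares if its left adjoint is
surjective on objects. -/
theorem of_map_of_adjunction (adj : L ⊣ R) (hL : Function.Surjective L.obj)
    (hcomm : f ≫ m = g ≫ n) (h : IsWeakPullback (R.map f) (R.map g) (R.map m) (R.map n)) :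
    IsWeakPullback f g m n := by
  refine ⟨hcomm, fun S p q hpq => ?_⟩
  obtain ⟨X, rfl⟩ := hL S
  obtain ⟨r, hf, hg⟩ := h.2 X (adj.homEquiv X D p) (adj.homEquiv X B q)
    (by rw [← adj.homEquiv_naturality_right, hpq, adj.homEquiv_naturality_right])
  refine ⟨(adj.homEquiv X A).symm r, ?_, ?_⟩
  · rw [← adj.homEquiv_naturality_right_symm, hf, Equiv.symm_apply_apply]
  · rw [← adj.homEquiv_naturality_right_symm, hg, Equiv.symm_apply_apply]

end IsWeakPullback

/-- A commutative square in the Kleisli category of a monad `T` is a weak pullback if and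
only if its image under the right adjoint `R : C_T ⥤ C` of the Kleisli adjunction is a
weak pullback in `C`. -/
theorem isWeakPullback_kleisli_iff_isWeakPullback_fromKleisli
    {C : Type u} [Category.{v} C] (T : Monad C)
    {A B D E : Kleisli T} (f : A ⟶ B) (g : A ⟶ D) (m : B ⟶ E) (n : D ⟶ E)
    (hcomm : f ≫ m = g ≫ n) :
    IsWeakPullback f g m n ↔
      IsWeakPullback ((Kleisli.Adjunction.fromKleisli T).map f)
        ((Kleisli.Adjunction.fromKleisli T).map g)
        ((Kleisli.Adjunction.fromKleisli T).map m)
        ((Kleisli.Adjunction.fromKleisli T).map n) :=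
  ⟨fun h => h.map_of_adjunction (Kleisli.Adjunction.adj T),
    fun h => h.of_map_of_adjunction (Kleisli.Adjunction.adj T) (fun S => ⟨S.of, rfl⟩) hcomm⟩
end

section
/- Let (T, μ, η) be a monad on a category C and let L: C → C_T be the left adjoint (free functor) of the Kleisli adjunction. Then the functor T sends weak pullback squares in C to weak pullback squares in C if and only if L sends weak pullback squares in C to weak pullback squares in C_T. -/
open CategoryTheory

universe v u

/-- Postcomposing a Kleisli morphism with a free morphism amounts to postcomposing with `T`
applied to the underlying morphism. -/
lemma CategoryTheory.Kleisli.comp_toKleisli_map_of {C : Type u} [Category.{v} C] {T : Monad C}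
    {X : Kleisli T} {A B : C} (k : X ⟶ (Kleisli.Adjunction.toKleisli T).obj A) (f : A ⟶ B) :
    (k ≫ (Kleisli.Adjunction.toKleisli T).map f).of = k.of ≫ T.map f := by
  have h : T.map (f ≫ T.η.app B) ≫ T.μ.app B = T.map f := by
    rw [Functor.map_comp, Category.assoc, T.right_unit]
    exact Category.comp_id _
  exact congrArg (k.of ≫ ·) h

/-- The endofunctor of a monad sends a commutative square to a weak pullback exactly when the
free functor to the Kleisli category does. -/
lemma isWeakPullback_map_iff_toKleisli_map {C : Type u} [Category.{v} C] (T : Monad C)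
    {A B D E : C} {f : A ⟶ B} {g : A ⟶ D} {m : B ⟶ E} {n : D ⟶ E} (w : f ≫ m = g ≫ n) :
    IsWeakPullback (T.map f) (T.map g) (T.map m) (T.map n) ↔
      IsWeakPullback ((Kleisli.Adjunction.toKleisli T).map f)
        ((Kleisli.Adjunction.toKleisli T).map g)
        ((Kleisli.Adjunction.toKleisli T).map m)
        ((Kleisli.Adjunction.toKleisli T).map n) := by
  constructor
  · rintro ⟨-, h⟩
    refine ⟨by rw [← Functor.map_comp, w, Functor.map_comp], fun S p q hpq => ?_⟩
    have e := congrArg Kleisli.Hom.of hpq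
    rw [Kleisli.comp_toKleisli_map_of, Kleisli.comp_toKleisli_map_of] at e
    obtain ⟨r, hf, hg⟩ := h S.of p.of q.of e
    exact ⟨.mk r, Kleisli.hom_ext ((Kleisli.comp_toKleisli_map_of _ f).trans hf),
      Kleisli.hom_ext ((Kleisli.comp_toKleisli_map_of _ g).trans hg)⟩
  · rintro ⟨-, h⟩
    refine ⟨by rw [← Functor.map_comp, w, Functor.map_comp], fun S p q hpq => ?_⟩
    obtain ⟨r, hf, hg⟩ := h (.mk T S) (.mk p) (.mk q) (Kleisli.hom_ext <|
      (Kleisli.comp_toKleisli_map_of _ m).trans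
        (hpq.trans (Kleisli.comp_toKleisli_map_of _ n).symm))
    exact ⟨r.of, (Kleisli.comp_toKleisli_map_of r f).symm.trans (congrArg Kleisli.Hom.of hf),
      (Kleisli.comp_toKleisli_map_of r g).symm.trans (congrArg Kleisli.Hom.of hg)⟩

/-- The endofunctor `T` of a monad sends weak pullback squares of `C` to weak pullback
squares of `C` if and only if the left adjoint `L : C ⥤ C_T` of the Kleisli adjunction
sends weak pullback squares of `C` to weak pullback squares of the Kleisli category. -/
theorem weaklyCartesian_iff_toKleisli_preserves_weak_pullbacks
    {C : Type u} [Category.{v} C] (T : Monad C) :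
    (∀ {A B D E : C} (f : A ⟶ B) (g : A ⟶ D) (m : B ⟶ E) (n : D ⟶ E),
        IsWeakPullback f g m n →
          IsWeakPullback (T.map f) (T.map g) (T.map m) (T.map n)) ↔
      (∀ {A B D E : C} (f : A ⟶ B) (g : A ⟶ D) (m : B ⟶ E) (n : D ⟶ E),
        IsWeakPullback f g m n →
          IsWeakPullback ((Kleisli.Adjunction.toKleisli T).map f)
            ((Kleisli.Adjunction.toKleisli T).map g)
            ((Kleisli.Adjunction.toKleisli T).map m)
            ((Kleisli.Adjunction.toKleisli T).map n)) := by
  exact ⟨fun h _ _ _ _ f g m n w => (isWeakPullback_map_iff_toKleisli_map T w.1).1 (h f g m n w),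
    fun h _ _ _ _ f g m n w => (isWeakPullback_map_iff_toKleisli_map T w.1).2 (h f g m n w)⟩
end

section
/- Let (T, μ, η) be a monad on a category C, with Kleisli category C_T, Kleisli adjunction L ⊣ R, and counit ε: L∘R ⇒ Id (so ε_X: TX → X in C_T is represented by the identity morphism of TX in C). Then the multiplication μ is weakly cartesian if and only if for every morphism f: X → Y of C, the commutative square in C_T with top L(Tf): TX → TY, left side ε_X: TX → X, right side ε_Y: TY → Y, and bottom L f: X → Y is a weak pullback in C_T. -/
open CategoryTheory

universe v u

namespace CategoryTheory.Kleisli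

variable {C : Type u} [Category.{v} C] {T : Monad C}

theorem comp_toKleisli_map_of_s3 {S : Kleisli T} {X Y : C}
    (p : S ⟶ (Adjunction.toKleisli T).obj X) (f : X ⟶ Y) :
    (p ≫ (Adjunction.toKleisli T).map f).of = p.of ≫ T.map f := by
  have h : T.map (f ≫ T.η.app Y) ≫ T.μ.app Y = T.map f := by simp
  exact congrArg (p.of ≫ ·) h

theorem comp_counit_app_of {S : Kleisli T} {X : C}
    (q : S ⟶ (Adjunction.toKleisli T).obj (T.obj X)) :
    (q ≫ (Adjunction.adj T).counit.app ((Adjunction.toKleisli T).obj X)).of =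
      q.of ≫ T.μ.app X := by
  have h : T.map (𝟙 (T.obj X)) ≫ T.μ.app X = T.μ.app X := by simp
  exact congrArg (q.of ≫ ·) h

end CategoryTheory.Kleisli

/-- The multiplication `μ` of a monad `T` is weakly cartesian if and only if, for every
morphism `f : X ⟶ Y` of `C`, the naturality square of the counit of the Kleisli
adjunction at `f` (with top `L(Tf)`, sides the counit components, bottom `L f`)
is a weak pullback in the Kleisli category. -/
theorem mu_weaklyCartesian_iff_counit_naturality_isWeakPullback
    {C : Type u} [Category.{v} C] (T : Monad C) :
    (∀ (X Y : C) (f : X ⟶ Y),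
        IsWeakPullback (T.map (T.map f)) (T.μ.app X) (T.μ.app Y) (T.map f)) ↔
      (∀ (X Y : C) (f : X ⟶ Y),
        IsWeakPullback ((Kleisli.Adjunction.toKleisli T).map (T.map f))
          ((Kleisli.Adjunction.adj T).counit.app ((Kleisli.Adjunction.toKleisli T).obj X))
          ((Kleisli.Adjunction.adj T).counit.app ((Kleisli.Adjunction.toKleisli T).obj Y))
          ((Kleisli.Adjunction.toKleisli T).map f)) := by
  constructor
  · intro h X Y f
    refine ⟨Kleisli.hom_ext ?_, fun S p q hpq => ?_⟩
    · refine (Kleisli.comp_counit_app_of _).trans <|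
        .trans ?_ (Kleisli.comp_toKleisli_map_of_s3 _ f).symm
      change (T.map f ≫ T.η.app (T.obj Y)) ≫ T.μ.app Y = 𝟙 (T.obj X) ≫ T.map f
      simp
    · have hpq' : q.of ≫ T.μ.app Y = p.of ≫ T.map f := by
        rw [← Kleisli.comp_counit_app_of, ← Kleisli.comp_toKleisli_map_of_s3]
        exact congrArg Kleisli.Hom.of hpq
      obtain ⟨r, hq, hp⟩ := (h X Y f).2 S.of p.of q.of hpq'
      refine ⟨.mk r, Kleisli.hom_ext ?_, Kleisli.hom_ext ?_⟩
      · exact (Kleisli.comp_toKleisli_map_of_s3 (T := T) (.mk r) (T.map f)).trans hq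
      · exact (Kleisli.comp_counit_app_of (T := T) (.mk r)).trans hp
  · intro h X Y f
    refine ⟨T.μ.naturality f, fun S p q hpq => ?_⟩
    let S' := Kleisli.mk T S
    let p' : S' ⟶ (Kleisli.Adjunction.toKleisli T).obj X := .mk p
    let q' : S' ⟶ (Kleisli.Adjunction.toKleisli T).obj (T.obj Y) := .mk q
    obtain ⟨r, hq, hp⟩ := (h X Y f).2 S' p' q' <| Kleisli.hom_ext <|
      (Kleisli.comp_counit_app_of q').trans <|
        hpq.trans (Kleisli.comp_toKleisli_map_of_s3 p' f).symm
    exact ⟨r.of, (Kleisli.comp_toKleisli_map_of_s3 r (T.map f)).symm.trans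
        (congrArg Kleisli.Hom.of hq),
      (Kleisli.comp_counit_app_of r).symm.trans (congrArg Kleisli.Hom.of hp)⟩
end

section
/- Let X and Y be standard Borel spaces and f: X → Y a measurable map. Let p be a probability measure on X, and let Π be a probability measure on Measure Y concentrated on probability measures, such that Π.join = p.map f. Then there exists a probability measure Ξ on Measure X, concentrated on probability measures, such that Ξ.join = p and Ξ.map (Measure.map f) = Π. (This is the pointwise form of the statement that the multiplication of the Giry monad on standard Borel spaces is weakly cartesian.) -/
open MeasureTheory

open ProbabilityTheory

/-- The conditional distribution of the identity given `f` is almost everywhere supported on the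
fibres of `f`. -/
lemma map_condDistrib_id_ae_eq_dirac
    {X Y : Type*} [MeasurableSpace X] [StandardBorelSpace X] [Nonempty X]
    [MeasurableSpace Y] [StandardBorelSpace Y] [Nonempty Y]
    {f : X → Y} (hf : Measurable f) (p : Measure X) [IsFiniteMeasure p] :
    ∀ᵐ y ∂p.map f, (condDistrib id f p y).map f = Measure.dirac y := by
  filter_upwards [condDistrib_comp f (μ := p) (Y := id) aemeasurable_id hf,
    condDistrib_self (μ := p) f] with y h₁ h₂
  rw [← Kernel.map_apply _ hf, ← h₁, Function.comp_id, h₂, Kernel.id_apply]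

/-- Pointwise form of the weak cartesianness of the multiplication of the Giry monad on
standard Borel spaces: given a probability measure `p` on `X` and a probability measure
`P` on `Measure Y` concentrated on probability measures with `P.join = p.map f`, there
is a probability measure `Ξ` on `Measure X`, concentrated on probability measures,
with `Ξ.join = p` and `Ξ.map (Measure.map f) = P`. -/
theorem giry_mu_weaklyCartesian_pointwise
    {X Y : Type*} [MeasurableSpace X] [StandardBorelSpace X]
    [MeasurableSpace Y] [StandardBorelSpace Y]
    (f : X → Y) (hf : Measurable f)
    (p : Measure X) [IsProbabilityMeasure p]
    (P : Measure (Measure Y)) [IsProbabilityMeasure P]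
    (hP : P {ν : Measure Y | ν Set.univ = 1} = 1)
    (hjoin : P.join = p.map f) :
    ∃ Ξ : Measure (Measure X), IsProbabilityMeasure Ξ ∧
      Ξ {ν : Measure X | ν Set.univ = 1} = 1 ∧
      Ξ.join = p ∧
      Ξ.map (Measure.map f) = P := by
  have : Nonempty X := nonempty_of_isProbabilityMeasure p
  have : Nonempty Y := Nonempty.map f inferInstance
  let k : Kernel Y X := condDistrib id f p
  have hk : Measurable fun ν : Measure Y ↦ ν.bind k := Measure.measurable_bind' k.measurable
  refine ⟨P.map fun ν ↦ ν.bind k, Measure.isProbabilityMeasure_map hk.aemeasurable, ?_, ?_, ?_⟩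
  · have hs : MeasurableSet {ν : Measure X | ν Set.univ = 1} :=
      Measure.measurable_coe .univ (measurableSet_singleton 1)
    rw [Measure.map_apply hk hs]
    refine Eq.trans ?_ hP
    congr 1 with ν
    simp [Measure.bind_apply .univ k.measurable.aemeasurable]
  · have h : (P.map fun ν ↦ ν.bind k).join = P.join.bind k := by
      rw [Measure.join_eq_bind P, Measure.bind_bind aemeasurable_id k.measurable.aemeasurable]
      rfl
    rw [h, hjoin, condDistrib_comp_map hf.aemeasurable aemeasurable_id, Measure.map_id]
  · rw [Measure.map_map (Measure.measurable_map f hf) hk]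
    conv_rhs => rw [← Measure.map_id (μ := P)]
    refine Measure.map_congr ?_
    have h := map_condDistrib_id_ae_eq_dirac hf p
    rw [← hjoin] at h
    filter_upwards [Measure.ae_ae_of_ae_join h] with ν hν
    simp only [Function.comp_apply, id_eq]
    rw [← Measure.bind_dirac_eq_map _ hf, Measure.bind_bind k.measurable.aemeasurable
      (by fun_prop)]
    simp only [Measure.bind_dirac_eq_map _ hf]
    exact (Measure.bind_congr_right hν).trans Measure.bind_dirac
end

section
/- Let A, X, Y be standard Borel spaces and f: X → Y a measurable map. Let p: A → Measure X be a Markov kernel (a measurable map with each p(a) a probability measure), and let Π: A → Measure (Measure Y) be measurable with each Π(a) a probability measure concentrated on probability measures, such that (Π a).join = (p a).map f for every a ∈ A. Then there exists a measurable map Ξ: A → Measure (Measure X), with each Ξ(a) a probability measure concentrated on probability measures, such that (Ξ a).join = p a and (Ξ a).map (Measure.map f) = Π a for every a ∈ A. (This is the parametrized form, over all Kleisli cones, of the statement that the multiplication of the Giry monad on standard Borel spaces is weakly cartesian.) -/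
open MeasureTheory ProbabilityTheory

/-- A Markov kernel `p` from `A` to `X` can be disintegrated along a measurable map `f`: there is
a Markov kernel `q` from `A × Y` to `X` recovering `p a` from its pushforward, and carried by the
fibres of `f`. -/
theorem exists_kernel_disintegration_along {A X Y : Type*} [MeasurableSpace A]
    [MeasurableSpace X] [StandardBorelSpace X] [Nonempty X]
    [MeasurableSpace Y] [StandardBorelSpace Y] {f : X → Y} (hf : Measurable f)
    (p : Kernel A X) [IsMarkovKernel p] :
    ∃ q : Kernel (A × Y) X, IsMarkovKernel q ∧
      (∀ a, ∀ s, MeasurableSet s → ∫⁻ y, q (a, y) s ∂((p a).map f) = p a s) ∧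
      ∀ a, ∀ᵐ y ∂((p a).map f), ∀ᵐ x ∂(q (a, y)), f x = y := by
  have hg : Measurable fun x => (f x, x) := hf.prodMk measurable_id
  let κ : Kernel A (Y × X) := p.map fun x => (f x, x)
  have : IsMarkovKernel κ := Kernel.IsMarkovKernel.map p hg
  have hκ (a : A) : κ a = (p a).map fun x => (f x, x) := Kernel.map_apply p hg a
  have hfst (a : A) : κ.fst a = (p a).map f := by
    rw [Kernel.fst_apply, hκ, Measure.map_map measurable_fst hg]
    rfl
  have hdis : κ.fst ⊗ₖ κ.condKernel = κ := κ.disintegrate κ.condKernel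
  refine ⟨κ.condKernel, inferInstance, fun a s hs => ?_, fun a => ?_⟩
  · have h : (κ.fst ⊗ₖ κ.condKernel) a (Prod.snd ⁻¹' s) = κ a (Prod.snd ⁻¹' s) := by rw [hdis]
    rw [Kernel.compProd_apply (measurable_snd hs), hfst, hκ,
      Measure.map_apply hg (measurable_snd hs)] at h
    exact h
  · rw [← hfst]
    refine Kernel.ae_ae_of_ae_compProd (p := fun z : Y × X => f z.2 = z.1) ?_
    rw [hdis, hκ, ae_map_iff hg.aemeasurable (p := fun z : Y × X => f z.2 = z.1)
      (measurableSet_eq_fun (hf.comp measurable_snd) measurable_fst)]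
    exact Filter.Eventually.of_forall fun _ => rfl

/-- Binding probability measures with a Markov kernel depending on a parameter is jointly
measurable in the parameter and in the measure. -/
theorem exists_kernel_parametrized_bind {A X Y : Type*} [MeasurableSpace A]
    [MeasurableSpace X] [MeasurableSpace Y] (q : Kernel (A × Y) X) [IsMarkovKernel q] :
    ∃ T : Kernel (A × Measure Y) X, ∀ a, ∀ ν : Measure Y, ν Set.univ = 1 →
      ∀ s, MeasurableSet s → T (a, ν) s = ∫⁻ y, q (a, y) s ∂ν := by
  classical
  have hS : MeasurableSet {c : A × Measure Y | c.2 Set.univ = 1} :=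
    ((Measure.measurable_coe MeasurableSet.univ).comp measurable_snd)
      (measurableSet_singleton 1)
  let k : Kernel (A × Measure Y) Y := Kernel.piecewise hS ⟨Prod.snd, measurable_snd⟩ 0
  have hk {a : A} {ν : Measure Y} (hν : ν Set.univ = 1) : k (a, ν) = ν := by
    simp [k, Kernel.piecewise_apply, hν]
  have : IsFiniteKernel k := ⟨⟨1, ENNReal.one_lt_top, fun c => by
    by_cases hc : c.2 Set.univ = 1
    · exact ((congrArg (fun ν => ν Set.univ) (hk (a := c.1) hc)).trans hc).le
    · simp [k, Kernel.piecewise_apply, hc]⟩⟩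
  let q' : Kernel ((A × Measure Y) × Y) X :=
    q.comap (fun c => (c.1.1, c.2)) (by fun_prop)
  refine ⟨(k ⊗ₖ q').snd, fun a ν hν s hs => ?_⟩
  rw [Kernel.snd_apply' _ _ hs, Kernel.compProd_apply (measurable_snd hs), hk hν]
  rfl

/-- A property holding almost everywhere for `Q.join` holds `ν`-almost everywhere for `Q`-almost
every `ν`. -/
theorem ae_ae_of_ae_join {Y : Type*} [MeasurableSpace Y] {Q : Measure (Measure Y)} {r : Y → Prop}
    (h : ∀ᵐ y ∂Q.join, r y) : ∀ᵐ ν ∂Q, ∀ᵐ y ∂ν, r y := by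
  have h0 := measure_toMeasurable {y | ¬ r y} (μ := Q.join)
  rw [ae_iff.1 h, Measure.join_apply (measurableSet_toMeasurable _ _),
    lintegral_eq_zero_iff (Measure.measurable_coe (measurableSet_toMeasurable _ _))] at h0
  filter_upwards [h0] with ν hν
  exact measure_mono_null (subset_toMeasurable _ _) hν

/-- Parametrized (Kleisli-cone) form of the weak cartesianness of the multiplication of
the Giry monad on standard Borel spaces: for a Markov kernel `p : A → Measure X` and a
measurable family `P : A → Measure (Measure Y)` of probability measures concentrated on
probability measures with `(P a).join = (p a).map f` for all `a`, there is a measurable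
family `Ξ : A → Measure (Measure X)` of probability measures concentrated on probability
measures with `(Ξ a).join = p a` and `(Ξ a).map (Measure.map f) = P a` for all `a`. -/
theorem giry_mu_weaklyCartesian_parametrized
    {A X Y : Type*} [MeasurableSpace A] [StandardBorelSpace A]
    [MeasurableSpace X] [StandardBorelSpace X]
    [MeasurableSpace Y] [StandardBorelSpace Y]
    (f : X → Y) (hf : Measurable f)
    (p : A → Measure X) (hp : Measurable p)
    (hp1 : ∀ a, IsProbabilityMeasure (p a))
    (P : A → Measure (Measure Y)) (hP : Measurable P)
    (hP1 : ∀ a, IsProbabilityMeasure (P a))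
    (hPconc : ∀ a, P a {ν : Measure Y | ν Set.univ = 1} = 1)
    (hjoin : ∀ a, (P a).join = (p a).map f) :
    ∃ Ξ : A → Measure (Measure X), Measurable Ξ ∧
      (∀ a, IsProbabilityMeasure (Ξ a)) ∧
      (∀ a, Ξ a {ν : Measure X | ν Set.univ = 1} = 1) ∧
      (∀ a, (Ξ a).join = p a) ∧
      (∀ a, (Ξ a).map (Measure.map f) = P a) := by
  rcases isEmpty_or_nonempty A with hA | ⟨⟨a₀⟩⟩
  · exact ⟨fun _ => 0, measurable_const, isEmptyElim, isEmptyElim, isEmptyElim, isEmptyElim⟩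
  have : Nonempty X := nonempty_of_isProbabilityMeasure (p a₀)
  let pK : Kernel A X := ⟨p, hp⟩
  have : IsMarkovKernel pK := ⟨hp1⟩
  let PK : Kernel A (Measure Y) := ⟨P, hP⟩
  have : IsMarkovKernel PK := ⟨hP1⟩
  obtain ⟨q, hq, hqp, hqf⟩ := exists_kernel_disintegration_along hf pK
  obtain ⟨T, hT⟩ := exists_kernel_parametrized_bind q
  have hTa (a : A) : Measurable fun ν => T (a, ν) := T.measurable.comp measurable_prodMk_left
  have hone : MeasurableSet {ν : Measure Y | ν Set.univ = 1} :=
    Measure.measurable_coe MeasurableSet.univ (measurableSet_singleton 1)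
  have hone' : MeasurableSet {ν : Measure X | ν Set.univ = 1} :=
    Measure.measurable_coe MeasurableSet.univ (measurableSet_singleton 1)
  have hPae (a : A) : ∀ᵐ ν ∂(P a), ν Set.univ = 1 :=
    (prob_compl_eq_zero_iff hone).2 (hPconc a)
  have hΞ : (fun a => (P a).map fun ν => T (a, ν)) = (Kernel.id ×ₖ PK).map T := by
    funext a
    rw [Kernel.map_apply _ T.measurable, Kernel.prod_apply, Kernel.id_apply, Measure.dirac_prod,
      Measure.map_map T.measurable measurable_prodMk_left]
    rfl
  have hΞprob (a : A) : IsProbabilityMeasure ((P a).map fun ν => T (a, ν)) :=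
    Measure.isProbabilityMeasure_map (hTa a).aemeasurable
  refine ⟨fun a => (P a).map fun ν => T (a, ν), ?_, hΞprob, fun a => ?_, fun a => ?_, fun a => ?_⟩
  · rw [hΞ]
    exact Kernel.measurable _
  · refine (prob_compl_eq_zero_iff hone').1 ((ae_map_iff (hTa a).aemeasurable hone').2 ?_)
    filter_upwards [hPae a] with ν hν
    rw [hT a ν hν _ MeasurableSet.univ]
    simp [hν]
  · ext s hs
    rw [Measure.join_apply hs, lintegral_map (Measure.measurable_coe hs) (hTa a),
      lintegral_congr_ae ((hPae a).mono fun ν hν => hT a ν hν s hs),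
      ← Measure.lintegral_join (f := fun y => q (a, y) s)
        ((q.measurable_coe hs).comp measurable_prodMk_left).aemeasurable, hjoin]
    exact hqp a s hs
  · rw [Measure.map_map (Measure.measurable_map f hf) (hTa a)]
    refine (Measure.map_congr ?_).trans Measure.map_id
    have hfib : ∀ᵐ y ∂(P a).join, ∀ᵐ x ∂(q (a, y)), f x = y := by
      rw [hjoin]
      exact hqf a
    filter_upwards [hPae a, ae_ae_of_ae_join hfib] with ν hν hνq
    ext B hB
    rw [Function.comp_apply, Measure.map_apply hf hB, hT a ν hν _ (hf hB), id_eq,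
      ← lintegral_indicator_one hB]
    refine lintegral_congr_ae ?_
    filter_upwards [hνq] with y hy
    have hmap : (q (a, y)).map f = Measure.dirac y := by
      rw [Measure.map_congr hy, Measure.map_const, measure_univ, one_smul]
    rw [← Measure.map_apply hf hB, hmap, Measure.dirac_apply' y hB]
end

section
/- Let X, Y, Z be standard Borel spaces, f: X → Z and g: Y → Z measurable maps, and let p and q be probability measures on X and Y respectively with p.map f = q.map g. Then there exists a probability measure ρ on X × Y such that ρ({(x,y) | f x = g y}) = 1, ρ.map Prod.fst = p, and ρ.map Prod.snd = q. (This is the pointwise form of the statement that the Giry functor on standard Borel spaces turns pullback squares into weak pullback squares.) -/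
open MeasureTheory

namespace MeasureTheory.Measure

open ProbabilityTheory

lemma map_prodMap_id_compProd_comap {X Y Z : Type*} [MeasurableSpace X] [MeasurableSpace Y]
    [MeasurableSpace Z] {f : X → Z} (hf : Measurable f) (p : Measure X) [SFinite p]
    (κ : Kernel Z Y) [IsSFiniteKernel κ] :
    (p ⊗ₘ κ.comap f hf).map (Prod.map f id) = p.map f ⊗ₘ κ := by
  ext s hs
  have hm : Measurable (Prod.map f id : X × Y → Z × Y) := hf.prodMap measurable_id
  rw [map_apply hm hs, compProd_apply (hm hs), compProd_apply hs,
    lintegral_map (Kernel.measurable_kernel_prodMk_left hs) hf]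
  rfl

end MeasureTheory.Measure

/-- Pointwise form of the statement that the Giry functor on standard Borel spaces turns
pullback squares into weak pullback squares: given measurable `f : X → Z`, `g : Y → Z`
and probability measures `p` on `X` and `q` on `Y` with `p.map f = q.map g`, there is a
probability measure `ρ` on `X × Y` concentrated on the pullback `{(x, y) | f x = g y}`
whose marginals are `p` and `q`. -/
theorem giry_turns_pullbacks_into_weak_pullbacks_pointwise
    {X Y Z : Type*} [MeasurableSpace X] [StandardBorelSpace X]
    [MeasurableSpace Y] [StandardBorelSpace Y]
    [MeasurableSpace Z] [StandardBorelSpace Z]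
    (f : X → Z) (g : Y → Z) (hf : Measurable f) (hg : Measurable g)
    (p : Measure X) (q : Measure Y)
    [IsProbabilityMeasure p] [IsProbabilityMeasure q]
    (h : p.map f = q.map g) :
    ∃ ρ : Measure (X × Y), IsProbabilityMeasure ρ ∧
      ρ {xy : X × Y | f xy.1 = g xy.2} = 1 ∧
      ρ.map Prod.fst = p ∧
      ρ.map Prod.snd = q := by
  have : Nonempty Y := q.nonempty_of_neZero
  set κ := ProbabilityTheory.condDistrib id g q
  have hm : Measurable (Prod.map f id : X × Y → Z × Y) := hf.prodMap measurable_id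
  have hgraph : Measurable fun y ↦ (g y, y) := hg.prodMk measurable_id
  have key : (p.compProd (κ.comap f hf)).map (Prod.map f id) = q.map fun y ↦ (g y, y) := by
    rw [Measure.map_prodMap_id_compProd_comap, h]
    exact ProbabilityTheory.compProd_map_condDistrib aemeasurable_id
  refine ⟨p.compProd (κ.comap f hf), inferInstance, ?_, Measure.fst_compProd p _, ?_⟩
  · have hs : MeasurableSet {zy : Z × Y | zy.1 = g zy.2} :=
      measurableSet_eq_fun measurable_fst (hg.comp measurable_snd)
    calc p.compProd (κ.comap f hf) {xy : X × Y | f xy.1 = g xy.2}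
        = (p.compProd (κ.comap f hf)).map (Prod.map f id) {zy : Z × Y | zy.1 = g zy.2} :=
          (Measure.map_apply hm hs).symm
      _ = 1 := by
        rw [key, Measure.map_apply hgraph hs]
        simp
  · calc (p.compProd (κ.comap f hf)).map Prod.snd
        = ((p.compProd (κ.comap f hf)).map (Prod.map f id)).map Prod.snd :=
          (Measure.map_map measurable_snd hm).symm
      _ = q := by
        rw [key, Measure.map_map measurable_snd hgraph]
        exact Measure.map_id
end

section
/- Let A, X, Y, Z be standard Borel spaces, f: X → Z and g: Y → Z measurable maps, and let p: A → Measure X and q: A → Measure Y be Markov kernels with (p a).map f = (q a).map g for every a ∈ A. Then there exists a Markov kernel ρ: A → Measure (X × Y) such that for every a ∈ A: (ρ a)({(x,y) | f x = g y}) = 1, (ρ a).map Prod.fst = p a, and (ρ a).map Prod.snd = q a. (This is the parametrized form, over all Kleisli cones, of the statement that the Giry functor on standard Borel spaces turns pullback squares into weak pullback squares.) -/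
open MeasureTheory

open ProbabilityTheory

lemma ProbabilityTheory.Kernel.compProd_map_prodMap_id {A Z X W : Type*} [MeasurableSpace A]
    [MeasurableSpace Z] [MeasurableSpace X] [MeasurableSpace W]
    (μ : Kernel A Z) [IsSFiniteKernel μ] (κ : Kernel (A × Z) W) [IsSFiniteKernel κ]
    {φ : W → X} (hφ : Measurable φ) :
    (μ ⊗ₖ κ).map (Prod.map id φ) = μ ⊗ₖ κ.map φ := by
  ext a s hs
  have hm : Measurable (Prod.map id φ : Z × W → Z × X) := measurable_id.prodMap hφ
  rw [Kernel.map_apply' _ hm _ hs, Kernel.compProd_apply (hm hs), Kernel.compProd_apply hs]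
  refine lintegral_congr fun z ↦ ?_
  rw [Kernel.map_apply' _ hφ _ (measurable_prodMk_left hs)]
  rfl

/-- The disintegration of the graph of `f` along `f`. -/
lemma ProbabilityTheory.Kernel.exists_map_compProd_eq_map_graph {A X Z : Type*}
    [MeasurableSpace A] [MeasurableSpace X] [StandardBorelSpace X] [Nonempty X]
    [MeasurableSpace Z] [MeasurableSpace.CountablyGenerated Z] (f : X → Z)
    (p : Kernel A X) [IsMarkovKernel p] :
    ∃ κ : Kernel (A × Z) X, IsMarkovKernel κ ∧
      p.map f ⊗ₖ κ = p.map (fun x ↦ (f x, x)) := by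
  refine ⟨(p.map (fun x ↦ (f x, x))).condKernel, inferInstance, ?_⟩
  have hfst : (p.map (fun x ↦ (f x, x))).fst = p.map f :=
    Kernel.fst_map_prod _ measurable_id
  rw [← hfst]
  exact Kernel.disintegrate _ _

/-- Parametrized (Kleisli-cone) form of the statement that the Giry functor on standard
Borel spaces turns pullback squares into weak pullback squares: given Markov kernels
`p : A → Measure X` and `q : A → Measure Y` with `(p a).map f = (q a).map g` for all
`a`, there is a Markov kernel `ρ : A → Measure (X × Y)` which for every `a` is
concentrated on the pullback `{(x, y) | f x = g y}` and has marginals `p a` and `q a`. -/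
theorem giry_turns_pullbacks_into_weak_pullbacks_parametrized
    {A X Y Z : Type*} [MeasurableSpace A] [StandardBorelSpace A]
    [MeasurableSpace X] [StandardBorelSpace X]
    [MeasurableSpace Y] [StandardBorelSpace Y]
    [MeasurableSpace Z] [StandardBorelSpace Z]
    (f : X → Z) (g : Y → Z) (hf : Measurable f) (hg : Measurable g)
    (p : A → Measure X) (hp : Measurable p) (hp1 : ∀ a, IsProbabilityMeasure (p a))
    (q : A → Measure Y) (hq : Measurable q) (hq1 : ∀ a, IsProbabilityMeasure (q a))
    (h : ∀ a, (p a).map f = (q a).map g) :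
    ∃ ρ : A → Measure (X × Y), Measurable ρ ∧
      (∀ a, IsProbabilityMeasure (ρ a)) ∧
      (∀ a, ρ a {xy : X × Y | f xy.1 = g xy.2} = 1) ∧
      (∀ a, (ρ a).map Prod.fst = p a) ∧
      (∀ a, (ρ a).map Prod.snd = q a) := by
  rcases isEmpty_or_nonempty A with hA | ⟨⟨a₀⟩⟩
  · exact ⟨fun _ ↦ 0, measurable_const, isEmptyElim, isEmptyElim, isEmptyElim, isEmptyElim⟩
  have : Nonempty X := (p a₀).nonempty_of_neZero
  have : Nonempty Y := (q a₀).nonempty_of_neZero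
  let P : Kernel A X := ⟨p, hp⟩
  let Q : Kernel A Y := ⟨q, hq⟩
  have : IsMarkovKernel P := ⟨hp1⟩
  have : IsMarkovKernel Q := ⟨hq1⟩
  have hPQ : P.map f = Q.map g := by
    ext1 a
    rw [Kernel.map_apply _ hf, Kernel.map_apply _ hg]
    exact h a
  have : IsMarkovKernel (P.map f) := Kernel.IsMarkovKernel.map P hf
  obtain ⟨κ, _, hκ⟩ := P.exists_map_compProd_eq_map_graph f
  obtain ⟨η, _, hη⟩ := Q.exists_map_compProd_eq_map_graph g
  rw [← hPQ] at hη
  let τ : Kernel A (Z × X × Y) := P.map f ⊗ₖ (κ ×ₖ η)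
  have hτP (a : A) : (τ a).map (Prod.map id Prod.fst) = (p a).map (fun x ↦ (f x, x)) := by
    rw [← Kernel.map_apply _ (by fun_prop), Kernel.compProd_map_prodMap_id _ _ measurable_fst,
      ← Kernel.fst_eq, Kernel.fst_prod, hκ, Kernel.map_apply _ (by fun_prop)]
    rfl
  have hτQ (a : A) : (τ a).map (Prod.map id Prod.snd) = (q a).map (fun y ↦ (g y, y)) := by
    rw [← Kernel.map_apply _ (by fun_prop), Kernel.compProd_map_prodMap_id _ _ measurable_snd,
      ← Kernel.snd_eq, Kernel.snd_prod, hη, Kernel.map_apply _ (by fun_prop)]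
    rfl
  have hf_ae (a : A) : ∀ᵐ w ∂τ a, f w.2.1 = w.1 := by
    have hs : MeasurableSet {w : Z × X | f w.2 = w.1} :=
      measurableSet_eq_fun (by fun_prop) (by fun_prop)
    have : ∀ᵐ w ∂(τ a).map (Prod.map id Prod.fst), f w.2 = w.1 := by
      rw [hτP, ae_map_iff (by fun_prop) hs]
      exact ae_of_all _ fun _ ↦ rfl
    exact ae_of_ae_map (by fun_prop) this
  have hg_ae (a : A) : ∀ᵐ w ∂τ a, g w.2.2 = w.1 := by
    have hs : MeasurableSet {w : Z × Y | g w.2 = w.1} :=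
      measurableSet_eq_fun (by fun_prop) (by fun_prop)
    have : ∀ᵐ w ∂(τ a).map (Prod.map id Prod.snd), g w.2 = w.1 := by
      rw [hτQ, ae_map_iff (by fun_prop) hs]
      exact ae_of_all _ fun _ ↦ rfl
    exact ae_of_ae_map (by fun_prop) this
  have hfg : MeasurableSet {xy : X × Y | f xy.1 = g xy.2} :=
    measurableSet_eq_fun (by fun_prop) (by fun_prop)
  refine ⟨τ.snd, τ.snd.measurable, fun a ↦ inferInstance, fun a ↦ ?_, fun a ↦ ?_, fun a ↦ ?_⟩
  · rw [← mem_ae_iff_prob_eq_one hfg, Kernel.snd_apply]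
    refine (ae_map_iff (by fun_prop) hfg).2 ?_
    filter_upwards [hf_ae a, hg_ae a] with w hfw hgw
    exact hfw.trans hgw.symm
  · have := congrArg (Measure.map Prod.snd) (hτP a)
    rw [Measure.map_map (by fun_prop) (by fun_prop),
      Measure.map_map (by fun_prop) (by fun_prop)] at this
    rw [Kernel.snd_apply, Measure.map_map (by fun_prop) (by fun_prop)]
    exact this.trans Measure.map_id
  · have := congrArg (Measure.map Prod.snd) (hτQ a)
    rw [Measure.map_map (by fun_prop) (by fun_prop),
      Measure.map_map (by fun_prop) (by fun_prop)] at this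
    rw [Kernel.snd_apply, Measure.map_map (by fun_prop) (by fun_prop)]
    exact this.trans Measure.map_id
end

section
/- Let W, X, Y, Z be standard Borel spaces and w: W → X, v: W → Y, f: X → Z, g: Y → Z measurable maps with f∘w = g∘v, such that the square is a weak pullback in the category of standard Borel spaces and measurable maps: for every standard Borel space S and measurable maps u: S → X, t: S → Y with f∘u = g∘t there exists a measurable r: S → W with w∘r = u and v∘r = t. Then for all probability measures p on X and q on Y with p.map f = q.map g, there exists a probability measure ρ on W with ρ.map w = p and ρ.map v = q. (This is a pointwise consequence of the statement that the Giry functor on standard Borel spaces preserves weak pullbacks.) -/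
open MeasureTheory

universe u

open ProbabilityTheory in
/-- Two probability measures with the same image in `Z` have a coupling concentrated on the
fibre product, namely the conditionally independent coupling over `Z`. -/
lemma exists_coupling_ae_eq_of_map_eq_map {X Y Z : Type*} [MeasurableSpace X]
    [MeasurableSpace Y] [StandardBorelSpace Y] [MeasurableSpace Z] [StandardBorelSpace Z]
    {f : X → Z} {g : Y → Z} (hf : Measurable f) (hg : Measurable g)
    (p : Measure X) (q : Measure Y) [IsProbabilityMeasure p] [IsProbabilityMeasure q]
    (h : p.map f = q.map g) :
    ∃ π : Measure (X × Y), IsProbabilityMeasure π ∧ π.map Prod.fst = p ∧ π.map Prod.snd = q ∧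
      ∀ᵐ z ∂π, f z.1 = g z.2 := by
  have : Nonempty Y := nonempty_of_isProbabilityMeasure q
  let κ : Kernel Z Y := condDistrib id g q
  have hdisint : q.map g ⊗ₘ κ = q.map (fun y ↦ (g y, y)) :=
    compProd_map_condDistrib measurable_id.aemeasurable
  have hgraph : ∀ᵐ z ∂(q.map g ⊗ₘ κ), z.1 = g z.2 := by
    rw [hdisint]
    exact (ae_map_iff (by fun_prop) (measurableSet_eq_fun (by fun_prop) (by fun_prop))).2
      (.of_forall fun _ ↦ rfl)
  refine ⟨p ⊗ₘ κ.comap f hf, inferInstance, Measure.fst_compProd .., ?_, ?_⟩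
  · change (p ⊗ₘ κ.comap f hf).snd = q
    rw [Measure.snd_compProd, ← Kernel.comp_deterministic_eq_comap, ← Measure.comp_assoc,
      Measure.deterministic_comp_eq_map, h]
    exact (condDistrib_comp_map hg.aemeasurable measurable_id.aemeasurable).trans
      Measure.map_id
  · have hfibre := Measure.ae_ae_of_ae_compProd hgraph
    rw [← h] at hfibre
    exact (Measure.ae_compProd_iff (measurableSet_eq_fun (by fun_prop) (by fun_prop))).2
      (ae_of_ae_map hf.aemeasurable hfibre)

/-- Pointwise consequence of the statement that the Giry functor on standard Borel spaces
preserves weak pullbacks: if a commutative square `f ∘ w = g ∘ v` of measurable maps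
between standard Borel spaces is a weak pullback (every measurable cone from a standard
Borel space factors measurably), then for all probability measures `p` on `X` and `q` on
`Y` with `p.map f = q.map g` there is a probability measure `ρ` on `W` with
`ρ.map w = p` and `ρ.map v = q`. -/
theorem giry_preserves_weak_pullbacks_pointwise
    {W X Y Z : Type u} [MeasurableSpace W] [StandardBorelSpace W]
    [MeasurableSpace X] [StandardBorelSpace X]
    [MeasurableSpace Y] [StandardBorelSpace Y]
    [MeasurableSpace Z] [StandardBorelSpace Z]
    (w : W → X) (v : W → Y) (f : X → Z) (g : Y → Z)
    (hw : Measurable w) (hv : Measurable v) (hf : Measurable f) (hg : Measurable g)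
    (hcomm : f ∘ w = g ∘ v)
    (hweak : ∀ (S : Type u) [MeasurableSpace S] [StandardBorelSpace S]
      (u : S → X) (t : S → Y), Measurable u → Measurable t → f ∘ u = g ∘ t →
        ∃ r : S → W, Measurable r ∧ w ∘ r = u ∧ v ∘ r = t)
    (p : Measure X) (q : Measure Y)
    [IsProbabilityMeasure p] [IsProbabilityMeasure q]
    (h : p.map f = q.map g) :
    ∃ ρ : Measure W, IsProbabilityMeasure ρ ∧ ρ.map w = p ∧ ρ.map v = q := by
  obtain ⟨π, hπ, hfst, hsnd, hae⟩ := exists_coupling_ae_eq_of_map_eq_map hf hg p q h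
  let S : Set (X × Y) := {z | f z.1 = g z.2}
  have hS : MeasurableSet S :=
    measurableSet_eq_fun (hf.comp measurable_fst) (hg.comp measurable_snd)
  have : StandardBorelSpace S := hS.standardBorel
  obtain ⟨r, hr, hwr, hvr⟩ := hweak S (fun s ↦ s.1.1) (fun s ↦ s.1.2)
    (by fun_prop) (by fun_prop) (funext fun s ↦ s.2)
  let σ : Measure S := π.comap Subtype.val
  have hσ : σ.map Subtype.val = π := by
    rw [map_comap_subtype_coe hS]
    exact Measure.restrict_eq_self_of_ae_mem hae
  have hmapw : (σ.map r).map w = p := by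
    rw [Measure.map_map hw hr, hwr, ← hfst, ← hσ,
      Measure.map_map measurable_fst measurable_subtype_coe]
    rfl
  have hmapv : (σ.map r).map v = q := by
    rw [Measure.map_map hv hr, hvr, ← hsnd, ← hσ,
      Measure.map_map measurable_snd measurable_subtype_coe]
    rfl
  have : IsProbabilityMeasure ((σ.map r).map w) := hmapw ▸ inferInstance
  exact ⟨σ.map r, Measure.isProbabilityMeasure_of_map w, hmapw, hmapv⟩
end

section
/- Let X be a standard Borel space. Define a relation on probability measures on Measure X that are concentrated on probability measures by: P ⤳ Q if and only if there exists a probability measure K on Measure (Measure X), concentrated on the set of probability measures on Measure X that are themselves concentrated on probability measures, such that K.join = P and K.map Measure.join = Q. Then this relation is transitive: if P ⤳ Q and Q ⤳ R then P ⤳ R. (This is the partial evaluation / second-order stochastic dominance relation for the free algebra of the Giry monad on a standard Borel space.) -/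
open MeasureTheory

/-- The partial evaluation relation (second-order stochastic dominance) for the free
algebra of the Giry monad on `X`: `P ⤳ Q` iff there is a probability measure `K` on
`Measure (Measure X)`, concentrated on probability measures on `Measure X` that are
themselves concentrated on probability measures, with `K.join = P` and
`K.map Measure.join = Q`. -/
def GiryPartialEval {X : Type*} [MeasurableSpace X]
    (P Q : Measure (Measure X)) : Prop :=
  ∃ K : Measure (Measure (Measure X)), IsProbabilityMeasure K ∧
    K {Λ : Measure (Measure X) |
        Λ Set.univ = 1 ∧ Λ {ν : Measure X | ν Set.univ = 1} = 1} = 1 ∧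
    K.join = P ∧ K.map Measure.join = Q

open ProbabilityTheory Filter Set
open scoped Topology

section RatCDF

theorem isRatStieltjesPoint_ratCast (f : StieltjesFunction ℝ)
    (h_bot : Tendsto f atBot (𝓝 0)) (h_top : Tendsto f atTop (𝓝 1)) :
    IsRatStieltjesPoint (id : (ℚ → ℝ) → ℚ → ℝ) (fun q ↦ f q) where
  mono _ _ hqr := f.mono (Rat.cast_le.2 hqr)
  tendsto_atTop_one := h_top.comp (tendsto_ratCast_atTop_iff.2 tendsto_id)
  tendsto_atBot_zero := h_bot.comp (tendsto_ratCast_atBot_iff.2 tendsto_id)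
  iInf_rat_gt_eq t := by
    refine Eq.trans (Equiv.iInf_congr (Equiv.subtypeEquivRight fun r ↦ ?_) fun r ↦ rfl)
      (f.iInf_rat_gt_eq t)
    simp

/-- The probability measure on `ℝ` with the given distribution function at rational points
(a default one if there is none) is a left inverse of the distribution function. -/
theorem measure_stieltjesOfMeasurableRat_cdf (μ : Measure ℝ) [IsProbabilityMeasure μ] :
    (stieltjesOfMeasurableRat id measurable_id fun q : ℚ ↦ cdf μ q).measure = μ := by
  have h : stieltjesOfMeasurableRat id measurable_id (fun q : ℚ ↦ cdf μ q) = cdf μ := by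
    ext x
    rw [← StieltjesFunction.iInf_rat_gt_eq, ← (cdf μ).iInf_rat_gt_eq]
    refine iInf_congr fun r ↦ ?_
    rw [stieltjesOfMeasurableRat_eq, toRatCDF_of_isRatStieltjesPoint
      (isRatStieltjesPoint_ratCast _ (tendsto_cdf_atBot μ) (tendsto_cdf_atTop μ))]
    rfl
  rw [h, measure_cdf]

variable {X : Type*} [MeasurableSpace X] [StandardBorelSpace X]

/-- The distribution function at rational points of a measure on a standard Borel space,
with respect to an embedding of the space into `ℝ`. -/
noncomputable def ratCDF (μ : Measure X) (q : ℚ) : ℝ :=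
  μ.real (embeddingReal X ⁻¹' Iic (q : ℝ))

/-- A measure on a standard Borel space with given distribution function at rational points. -/
noncomputable def measureOfRatCDF (u : ℚ → ℝ) : Measure X :=
  (stieltjesOfMeasurableRat id measurable_id u).measure.comap (embeddingReal X)

theorem measurable_ratCDF : Measurable (ratCDF : Measure X → ℚ → ℝ) :=
  measurable_pi_lambda _ fun _ ↦
    (Measure.measurable_coe (measurable_embeddingReal X measurableSet_Iic)).ennreal_toReal

theorem measurable_measureOfRatCDF : Measurable (measureOfRatCDF : (ℚ → ℝ) → Measure X) := by
  refine Measure.measurable_of_measurable_coe _ fun s hs ↦ ?_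
  simp_rw [measureOfRatCDF, (measurableEmbedding_embeddingReal X).comap_apply]
  exact (Measure.measurable_coe
    ((measurableEmbedding_embeddingReal X).measurableSet_image.2 hs)).comp
      (measurable_measure_stieltjesOfMeasurableRat measurable_id)

theorem measureOfRatCDF_ratCDF (μ : Measure X) [IsProbabilityMeasure μ] :
    measureOfRatCDF (ratCDF μ) = μ := by
  have he := measurableEmbedding_embeddingReal X
  have := Measure.isProbabilityMeasure_map (μ := μ) he.measurable.aemeasurable
  have h : ratCDF μ = fun q : ℚ ↦ cdf (μ.map (embeddingReal X)) q := by
    ext q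
    rw [cdf_eq_real, map_measureReal_apply he.measurable measurableSet_Iic, ratCDF]
  rw [h, measureOfRatCDF, measure_stieltjesOfMeasurableRat_cdf, he.comap_map]

theorem measure_eq_of_ratCDF_eq {μ ν : Measure X} [IsProbabilityMeasure μ]
    [IsProbabilityMeasure ν] (h : ratCDF μ = ratCDF ν) : μ = ν := by
  rw [← measureOfRatCDF_ratCDF μ, h, measureOfRatCDF_ratCDF]

end RatCDF

/-- Disintegration along the first coordinate, for a second coordinate that is almost everywhere
a measurable retract of a standard Borel space. -/
theorem exists_isMarkovKernel_compProd_eq_of_retract {α β Ω : Type*} [MeasurableSpace α]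
    [MeasurableSpace β] [MeasurableSpace Ω] [StandardBorelSpace Ω] [Nonempty Ω]
    (ρ : Measure (α × β)) [IsFiniteMeasure ρ] {f : β → Ω} {g : Ω → β}
    (hf : Measurable f) (hg : Measurable g) (hgf : ∀ᵐ p ∂ρ, g (f p.2) = p.2) :
    ∃ η : Kernel α β, IsMarkovKernel η ∧ ρ.fst ⊗ₘ η = ρ := by
  refine ⟨(condDistrib (f ∘ Prod.snd) Prod.fst ρ).map g, Kernel.IsMarkovKernel.map _ hg, ?_⟩
  have hf' : Measurable (f ∘ Prod.snd : α × β → Ω) := hf.comp measurable_snd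
  rw [Measure.compProd_map hg, Measure.fst, compProd_map_condDistrib hf'.aemeasurable,
    Measure.map_map (measurable_id.prodMap hg) (measurable_fst.prodMk hf')]
  refine Eq.trans (Measure.map_congr ?_) Measure.map_id
  filter_upwards [hgf] with p hp
  exact Prod.ext rfl hp

namespace GiryPartialEval

variable {X : Type*} [MeasurableSpace X]

theorem measurableSet_measure_univ_eq_one :
    MeasurableSet {ν : Measure X | ν univ = 1} :=
  Measure.measurable_coe .univ (measurableSet_singleton 1)

/-- The identity kernel from measures to points, modified to be a Markov kernel. -/
noncomputable def evalKernel (α : Type*) [MeasurableSpace α] [Inhabited α] :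
    Kernel (Measure α) α := by
  classical
  exact
  { toFun := fun ν ↦ if ν univ = 1 then ν else Measure.dirac default
    measurable' := Measurable.ite measurableSet_measure_univ_eq_one measurable_id
      measurable_const }

theorem evalKernel_apply {α : Type*} [MeasurableSpace α] [Inhabited α] {ν : Measure α}
    (hν : ν univ = 1) : evalKernel α ν = ν :=
  if_pos hν

instance (α : Type*) [MeasurableSpace α] [Inhabited α] : IsMarkovKernel (evalKernel α) where
  isProbabilityMeasure ν := by
    by_cases hν : ν univ = 1
    · rw [evalKernel_apply hν]
      exact ⟨hν⟩
    · rw [show evalKernel α ν = Measure.dirac default from if_neg hν]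
      infer_instance

theorem ae_measure_univ_eq_one {P : Measure (Measure X)} [IsProbabilityMeasure P]
    (hP : P {ν : Measure X | ν univ = 1} = 1) : ∀ᵐ ν ∂P, ν univ = 1 :=
  (mem_ae_iff_prob_eq_one measurableSet_measure_univ_eq_one).2 hP

/-- A partial evaluation from `P` to `Q` is a kernel with barycenters `Q`-almost everywhere
the identity that carries `Q` to `P`. -/
theorem exists_kernel [StandardBorelSpace X] {P Q : Measure (Measure X)}
    [IsProbabilityMeasure P] [IsProbabilityMeasure Q]
    (hP : P {ν : Measure X | ν univ = 1} = 1) (hQ : Q {ν : Measure X | ν univ = 1} = 1)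
    (hPQ : GiryPartialEval P Q) :
    ∃ η : Kernel (Measure X) (Measure X), IsMarkovKernel η ∧ Q.bind η = P ∧
      ∀ᵐ ν ∂Q, (η ν).join = ν := by
  obtain ⟨K, hK, hK1, rfl, rfl⟩ := hPQ
  have hK_univ : ∀ᵐ Λ ∂K, Λ univ = 1 :=
    ae_measure_univ_eq_one (le_antisymm prob_le_one (hK1.ge.trans (measure_mono fun _ h ↦ h.1)))
  set σ := K ⊗ₘ evalKernel (Measure X) with hσ
  have hjoin : Measurable (fun p : Measure (Measure X) × Measure X ↦ (p.1.join, p.2)) :=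
    (Measure.measurable_join.comp measurable_fst).prodMk measurable_snd
  set ρ := σ.map fun p ↦ (p.1.join, p.2) with hρ
  have : IsProbabilityMeasure ρ := Measure.isProbabilityMeasure_map hjoin.aemeasurable
  have hρ_fst : ρ.fst = K.map Measure.join := by
    rw [Measure.fst, hρ, Measure.map_map measurable_fst hjoin, ← Measure.fst_compProd K
      (evalKernel (Measure X)), Measure.fst, Measure.map_map Measure.measurable_join measurable_fst]
    rfl
  have hρ_snd : ρ.snd = K.join := by
    rw [Measure.snd, hρ, Measure.map_map measurable_snd hjoin]
    change σ.snd = _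
    rw [Measure.snd_compProd, Measure.join_eq_bind]
    exact Measure.bind_congr_right (hK_univ.mono fun Λ h ↦ evalKernel_apply h)
  have hρ_ae : ∀ᵐ p ∂ρ, measureOfRatCDF (ratCDF p.2) = p.2 := by
    have h : ∀ᵐ ν ∂ρ.snd, measureOfRatCDF (ratCDF ν) = ν := by
      rw [hρ_snd]
      filter_upwards [ae_measure_univ_eq_one hP] with ν hν
      have : IsProbabilityMeasure ν := ⟨hν⟩
      exact measureOfRatCDF_ratCDF ν
    exact ae_of_ae_map measurable_snd.aemeasurable h
  obtain ⟨η, hη, hηρ⟩ := exists_isMarkovKernel_compProd_eq_of_retract ρ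
    measurable_ratCDF measurable_measureOfRatCDF hρ_ae
  rw [hρ_fst] at hηρ
  have hbind : (K.map Measure.join).bind η = K.join := by
    rw [← Measure.snd_compProd, hηρ, hρ_snd]
  refine ⟨η, hη, hbind, ?_⟩
  have hset (A : Set X) (hA : MeasurableSet A) :
      ∀ᵐ ν ∂K.map Measure.join, (η ν).join A = ν A := by
    have hA' : Measurable fun p : Measure X × Measure X ↦ p.2 A :=
      (Measure.measurable_coe hA).comp measurable_snd
    refine ae_eq_of_forall_setLIntegral_eq_of_sigmaFinite
      ((Measure.measurable_coe hA).comp (Measure.measurable_join.comp η.measurable))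
      (Measure.measurable_coe hA) fun B hB _ ↦ ?_
    calc ∫⁻ ν in B, (η ν).join A ∂K.map Measure.join
      _ = ∫⁻ p in B ×ˢ univ, p.2 A ∂ρ := by
        rw [← hηρ, Measure.setLIntegral_compProd hA' hB .univ]
        simp_rw [Measure.join_apply hA, Measure.restrict_univ]
      _ = ∫⁻ p in (Measure.join ⁻¹' B) ×ˢ univ, p.2 A ∂σ := by
        rw [hρ, setLIntegral_map (hB.prod .univ) hA' hjoin]
        rfl
      _ = ∫⁻ Λ in Measure.join ⁻¹' B, Λ.join A ∂K := by
        have hA'' : Measurable fun p : Measure (Measure X) × Measure X ↦ p.2 A :=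
          (Measure.measurable_coe hA).comp measurable_snd
        rw [hσ, Measure.setLIntegral_compProd hA'' (Measure.measurable_join hB) .univ]
        refine lintegral_congr_ae (ae_restrict_of_ae (hK_univ.mono fun Λ hΛ ↦ ?_))
        simp [evalKernel_apply hΛ, Measure.join_apply hA]
      _ = ∫⁻ ν in B, ν A ∂K.map Measure.join := by
        rw [setLIntegral_map hB (Measure.measurable_coe hA) Measure.measurable_join]
  have hrat : ∀ᵐ ν ∂K.map Measure.join, ∀ q : ℚ,
      (η ν).join (embeddingReal X ⁻¹' Iic (q : ℝ)) = ν (embeddingReal X ⁻¹' Iic (q : ℝ)) :=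
    ae_all_iff.2 fun q ↦ hset _ (measurable_embeddingReal X measurableSet_Iic)
  filter_upwards [hrat, hset univ .univ, ae_measure_univ_eq_one hQ] with ν hν hν_join hν_univ
  have : IsProbabilityMeasure ν := ⟨hν_univ⟩
  have : IsProbabilityMeasure (η ν).join := ⟨hν_join.trans hν_univ⟩
  exact measure_eq_of_ratCDF_eq (funext fun q ↦ congrArg ENNReal.toReal (hν q))

theorem of_ae_measure_univ_eq_one {P R : Measure (Measure X)} [IsProbabilityMeasure P]
    (hP : P {ν : Measure X | ν univ = 1} = 1) {M : Measure (Measure (Measure X))}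
    [IsProbabilityMeasure M] (hM : ∀ᵐ Λ ∂M, Λ univ = 1) (hMP : M.join = P)
    (hMR : M.map Measure.join = R) : GiryPartialEval P R := by
  subst hMP
  have hmeas : MeasurableSet {Λ : Measure (Measure X) |
      Λ univ = 1 ∧ Λ {ν : Measure X | ν univ = 1} = 1} :=
    measurableSet_measure_univ_eq_one.inter
      (Measure.measurable_coe measurableSet_measure_univ_eq_one (measurableSet_singleton 1))
  refine ⟨M, ‹_›, (mem_ae_iff_prob_eq_one hmeas).1 ?_, rfl, hMR⟩
  filter_upwards [hM, Measure.ae_ae_of_ae_join (ae_measure_univ_eq_one hP)] with Λ hΛ hΛ_ae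
  have : IsProbabilityMeasure Λ := ⟨hΛ⟩
  exact ⟨hΛ, (mem_ae_iff_prob_eq_one measurableSet_measure_univ_eq_one).1 hΛ_ae⟩

end GiryPartialEval

/-- For a standard Borel space `X`, the partial evaluation relation on probability
measures on `Measure X` concentrated on probability measures is transitive. -/
theorem giryPartialEval_trans {X : Type*} [MeasurableSpace X] [StandardBorelSpace X]
    (P Q R : Measure (Measure X))
    [IsProbabilityMeasure P] [IsProbabilityMeasure Q] [IsProbabilityMeasure R]
    (hP : P {ν : Measure X | ν Set.univ = 1} = 1)
    (hQ : Q {ν : Measure X | ν Set.univ = 1} = 1)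
    (hR : R {ν : Measure X | ν Set.univ = 1} = 1)
    (hPQ : GiryPartialEval P Q) (hQR : GiryPartialEval Q R) :
    GiryPartialEval P R := by
  obtain ⟨η, hη, hηP, hη_join⟩ := GiryPartialEval.exists_kernel hP hQ hPQ
  obtain ⟨L, hL, hL1, rfl, rfl⟩ := hQR
  have hbind : Measurable fun Λ : Measure (Measure X) ↦ Λ.bind η :=
    Measure.measurable_bind' η.measurable
  have hL_univ : ∀ᵐ Λ ∂L, Λ univ = 1 := GiryPartialEval.ae_measure_univ_eq_one
    (le_antisymm prob_le_one (hL1.ge.trans (measure_mono fun _ h ↦ h.1)))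
  have hM_join : (L.map fun Λ ↦ Λ.bind η).join = P := by
    rw [← hηP, Measure.join_eq_bind L, Measure.bind_bind aemeasurable_id η.aemeasurable,
      Measure.bind]
    simp only [id_eq]
  have hM : IsProbabilityMeasure (L.map fun Λ ↦ Λ.bind η) :=
    Measure.isProbabilityMeasure_map hbind.aemeasurable
  have hM_univ : ∀ᵐ Λ ∂L.map fun Λ ↦ Λ.bind η, Λ univ = 1 := by
    rw [ae_map_iff hbind.aemeasurable GiryPartialEval.measurableSet_measure_univ_eq_one]
    filter_upwards [hL_univ] with Λ hΛ
    simp [Measure.bind_apply .univ η.aemeasurable, hΛ]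
  refine GiryPartialEval.of_ae_measure_univ_eq_one hP hM_univ hM_join ?_
  rw [Measure.map_map Measure.measurable_join hbind]
  refine Measure.map_congr ?_
  filter_upwards [Measure.ae_ae_of_ae_join hη_join] with Λ hΛ
  calc (Λ.bind η).join = Λ.bind fun ν ↦ (η ν).join := by
        rw [Measure.join_eq_bind, Measure.bind_bind η.aemeasurable aemeasurable_id]
        simp_rw [Measure.join_eq_bind]
    _ = Λ.join := by rw [Measure.bind_congr_right hΛ, Measure.join_eq_bind]; rfl
end

section
/- Let X and Y be standard Borel spaces, p a probability measure on X, and f, g: X → Measure Y Markov kernels. Then the following are equivalent: (i) f x = g x for p-almost every x ∈ X (equivalently, ∫_S f(x)(T) dp(x) = ∫_S g(x)(T) dp(x) for all measurable S ⊆ X and T ⊆ Y); (ii) for every probability measure π on Measure X concentrated on probability measures and satisfying π.join = p, one has ν.bind f = ν.bind g for π-almost every ν ∈ Measure X. (This is the instantiation in the category of standard Borel spaces and Markov kernels of the characterization of almost sure equality via decompositions, which holds because this Markov category is a.s.-compatibly representable and has conditionals.) -/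
open MeasureTheory

/-- Characterization of almost sure equality of Markov kernels via decompositions, in the
category of standard Borel spaces and Markov kernels: two Markov kernels `f, g : X →
Measure Y` agree `p`-almost surely if and only if, for every probability measure `π` on
`Measure X` concentrated on probability measures with `π.join = p`, we have
`ν.bind f = ν.bind g` for `π`-almost every `ν`. -/
theorem ae_eq_kernels_iff_ae_bind_eq_of_decompositions
    {X Y : Type*} [MeasurableSpace X] [StandardBorelSpace X]
    [MeasurableSpace Y] [StandardBorelSpace Y]
    (p : Measure X) [IsProbabilityMeasure p]
    (f g : X → Measure Y) (hf : Measurable f) (hg : Measurable g)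
    (hf1 : ∀ x, IsProbabilityMeasure (f x)) (hg1 : ∀ x, IsProbabilityMeasure (g x)) :
    (∀ᵐ x ∂p, f x = g x) ↔
      ∀ π : Measure (Measure X), IsProbabilityMeasure π →
        π {ν : Measure X | ν Set.univ = 1} = 1 → π.join = p →
          ∀ᵐ ν ∂π, ν.bind f = ν.bind g := by
  constructor
  · rintro h π - - rfl
    filter_upwards [Measure.ae_ae_of_ae_join h] with ν hν
    exact Measure.bind_congr_right hν
  · intro h
    have hd : Measurable (Measure.dirac : X → Measure X) := Measure.measurable_dirac
    have hmass : MeasurableSet {ν : Measure X | ν Set.univ = 1} :=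
      Measure.measurable_coe MeasurableSet.univ (measurableSet_singleton 1)
    have key := h (p.map Measure.dirac) (Measure.isProbabilityMeasure_map hd.aemeasurable)
      (by simp [Measure.map_apply hd hmass]) (Measure.join_map_dirac p)
    filter_upwards [ae_of_ae_map hd.aemeasurable key] with x hx
    rwa [Measure.dirac_bind hf, Measure.dirac_bind hg] at hx
end

section
/- Let Θ and X be standard Borel spaces, p a probability measure on Θ, and f: Θ → X a measurable map (a deterministic statistical experiment on (Θ, p)). Let q = p.map f, let m = p.map (θ ↦ (f θ, θ)) be the joint distribution on X × Θ, and let f̂ = q.map (x ↦ m.condKernel x), a probability measure on Measure Θ (the standard measure, or hypernormalization, of p with respect to f). Then for every probability measure π on Measure Θ, concentrated on probability measures, such that π.join = p and π.map (Measure.map f) = q.map Measure.dirac, there exists a probability measure K on Measure (Measure Θ), concentrated on the set of probability measures on Measure Θ that are themselves concentrated on probability measures, such that K.join = π and K.map Measure.join = f̂. (That is, there is a partial evaluation from π to the standard measure f̂: the hypernormalization is the coarsest decomposition of p that is finer than or equal to the partition induced by f.) -/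
open MeasureTheory

open ProbabilityTheory in
lemma isRatStieltjesPoint_cdf (μ : Measure ℝ) :
    IsRatStieltjesPoint id (fun r : ℚ ↦ cdf μ r) where
  mono _ _ h := (cdf μ).mono (Rat.cast_le.mpr h)
  tendsto_atTop_one := (tendsto_cdf_atTop μ).comp <|
    tendsto_ratCast_atTop_iff.mpr Filter.tendsto_id
  tendsto_atBot_zero := (tendsto_cdf_atBot μ).comp <|
    tendsto_ratCast_atBot_iff.mpr Filter.tendsto_id
  iInf_rat_gt_eq t := by
    have h := (cdf μ).iInf_rat_gt_eq (t : ℝ)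
    refine Eq.trans ?_ h
    refine Equiv.iInf_congr (Equiv.subtypeEquivRight fun r ↦ ?_) fun r ↦ rfl
    simp

open ProbabilityTheory in
/-- Probability measures on a standard Borel space can be measurably encoded as points of the
standard Borel space `ℚ → ℝ`, with a Markov kernel as decoding map. -/
lemma exists_measurable_encoding_of_standardBorelSpace (Θ : Type*) [MeasurableSpace Θ]
    [StandardBorelSpace Θ] [Nonempty Θ] :
    ∃ (enc : Measure Θ → ℚ → ℝ) (dec : Kernel (ℚ → ℝ) Θ),
      Measurable enc ∧ IsMarkovKernel dec ∧
        ∀ ν : Measure Θ, IsProbabilityMeasure ν → dec (enc ν) = ν := by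
  have he := measurableEmbedding_embeddingReal Θ
  let η : Kernel (ℚ → ℝ) ℝ :=
    ⟨fun a ↦ (stieltjesOfMeasurableRat id measurable_id a).measure,
      measurable_measure_stieltjesOfMeasurableRat measurable_id⟩
  have : IsMarkovKernel η := ⟨fun a ↦ instIsProbabilityMeasure_stieltjesOfMeasurableRat _ a⟩
  refine ⟨fun ν r ↦ (ν.map (embeddingReal Θ)).real (Set.Iic (r : ℝ)),
    Kernel.borelMarkovFromReal Θ η, ?_, inferInstance, fun ν hν ↦ ?_⟩
  · refine measurable_pi_lambda _ fun r ↦ ?_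
    exact ((Measure.measurable_coe measurableSet_Iic).comp
      (Measure.measurable_map _ he.measurable)).ennreal_toReal
  · have := Measure.isProbabilityMeasure_map (μ := ν) he.measurable.aemeasurable
    have hη : η (fun r : ℚ ↦ (ν.map (embeddingReal Θ)).real (Set.Iic (r : ℝ)))
        = ν.map (embeddingReal Θ) := by
      simp_rw [← cdf_eq_real]
      conv_rhs => rw [← measure_cdf (ν.map (embeddingReal Θ))]
      change StieltjesFunction.measure (stieltjesOfMeasurableRat id measurable_id _) = _
      congr 1
      ext x
      rw [← StieltjesFunction.iInf_rat_gt_eq, ← StieltjesFunction.iInf_rat_gt_eq]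
      refine iInf_congr fun r ↦ ?_
      rw [stieltjesOfMeasurableRat_eq,
        toRatCDF_of_isRatStieltjesPoint (isRatStieltjesPoint_cdf _)]
      rfl
    rw [Kernel.borelMarkovFromReal_apply, hη, if_pos, he.comap_map]
    rw [Measure.map_apply he.measurable he.measurableSet_range.compl]
    simp

/-- On a standard Borel space, the point can be measurably recovered from its Dirac measure. -/
lemma exists_measurable_leftInverse_dirac (X : Type*) [MeasurableSpace X]
    [StandardBorelSpace X] [Nonempty X] :
    ∃ D : Measure X → X, Measurable D ∧ ∀ x, D (Measure.dirac x) = x := by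
  obtain ⟨enc, dec, henc, -, hdec⟩ := exists_measurable_encoding_of_standardBorelSpace X
  have hinj : Function.Injective (fun x : X ↦ enc (Measure.dirac x)) := fun x y h ↦ by
    have h' := congrArg dec h
    simp only [hdec _ Measure.dirac.isProbabilityMeasure] at h'
    by_contra hxy
    have := congrArg (fun μ : Measure X ↦ μ {x}) h'
    simp [Ne.symm hxy] at this
  obtain ⟨g, hg, hgid⟩ := ((henc.comp Measure.measurable_dirac).measurableEmbedding
    hinj).exists_measurable_extend measurable_id fun _ ↦ inferInstance
  exact ⟨g ∘ enc, hg.comp henc, fun x ↦ congrFun hgid x⟩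

open ProbabilityTheory in
/-- A random probability measure on a standard Borel space can be disintegrated along any
measurable map to a standard Borel space, although `Measure Θ` is not itself standard Borel. -/
lemma exists_kernel_compProd_eq_map_prodMk {Θ X : Type*} [MeasurableSpace Θ]
    [StandardBorelSpace Θ] [Nonempty Θ] [MeasurableSpace X]
    (π : Measure (Measure Θ)) [IsFiniteMeasure π] (hπ : ∀ᵐ ν ∂π, IsProbabilityMeasure ν)
    {g : Measure Θ → X} (hg : Measurable g) :
    ∃ κ : Kernel X (Measure Θ), IsMarkovKernel κ ∧
      (∀ x, ∀ᵐ ν ∂κ x, IsProbabilityMeasure ν) ∧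
      π.map g ⊗ₘ κ = π.map (fun ν ↦ (g ν, ν)) := by
  obtain ⟨enc, dec, henc, hmarkov, hdec⟩ := exists_measurable_encoding_of_standardBorelSpace Θ
  let ρ := π.map fun ν ↦ (g ν, enc ν)
  have hρfst : ρ.fst = π.map g := Measure.fst_map_prodMk henc
  refine ⟨ρ.condKernel.map dec, Kernel.IsMarkovKernel.map _ dec.measurable, fun x ↦ ?_, ?_⟩
  · rw [Kernel.map_apply _ dec.measurable]
    have : ∀ᵐ a ∂ρ.condKernel x, IsProbabilityMeasure (dec a) :=
      ae_of_all _ fun a ↦ inferInstance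
    refine (ae_map_iff dec.measurable.aemeasurable ?_).mpr this
    simp_rw [isProbabilityMeasure_iff]
    exact Measure.measurable_coe MeasurableSet.univ (measurableSet_singleton 1)
  · rw [← hρfst, Measure.compProd_map dec.measurable, ρ.disintegrate,
      Measure.map_map (by fun_prop) (by fun_prop)]
    refine Measure.map_congr ?_
    filter_upwards [hπ] with ν hν
    simp [hdec ν hν]

open ProbabilityTheory in
/-- If almost every `ν` is concentrated on the fibre of `f` over `g ν`, then averaging the
disintegration of `π` along `g` gives the disintegration of `π.join` along `f`. -/
lemma map_join_prodMk_eq_compProd {Θ X : Type*} [MeasurableSpace Θ] [MeasurableSpace X]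
    (π : Measure (Measure Θ)) [IsFiniteMeasure π] [IsFiniteMeasure π.join]
    (hπ : ∀ᵐ ν ∂π, IsProbabilityMeasure ν) {f : Θ → X} (hf : Measurable f)
    {g : Measure Θ → X} (hg : Measurable g)
    (hfg : ∀ S, MeasurableSet S → ∀ᵐ ν ∂π, ν (f ⁻¹' S) = (g ⁻¹' S).indicator 1 ν)
    (κ : Kernel X (Measure Θ)) [IsMarkovKernel κ]
    (hκ : π.map g ⊗ₘ κ = π.map (fun ν ↦ (g ν, ν)))
    (η : Kernel X Θ) [IsMarkovKernel η] (hη : ∀ x, η x = (κ x).join) :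
    π.join.map (fun θ ↦ (f θ, θ)) = π.map g ⊗ₘ η := by
  refine Measure.ext_prod fun {S T} hS hT ↦ ?_
  have hT' : Measurable fun ν : Measure Θ ↦ ν T := Measure.measurable_coe hT
  have hT'' : Measurable fun z : X × Measure Θ ↦ z.2 T := hT'.comp measurable_snd
  have hpre : (fun θ ↦ (f θ, θ)) ⁻¹' S ×ˢ T = f ⁻¹' S ∩ T := by ext; simp
  rw [Measure.map_apply (by fun_prop) (hS.prod hT), hpre, Measure.join_apply ((hf hS).inter hT),
    Measure.compProd_apply_prod hS hT]
  calc ∫⁻ ν, ν (f ⁻¹' S ∩ T) ∂π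
      = ∫⁻ ν, (g ⁻¹' S).indicator (fun ν ↦ ν T) ν ∂π := by
        refine lintegral_congr_ae ?_
        filter_upwards [hπ, hfg S hS] with ν hν hνS
        by_cases h : ν ∈ g ⁻¹' S
        · rw [Set.indicator_of_mem h] at hνS ⊢
          rw [Set.inter_comm, measure_inter_conull]
          exact (prob_compl_eq_zero_iff (hf hS)).mpr hνS
        · rw [Set.indicator_of_notMem h] at hνS ⊢
          exact measure_mono_null Set.inter_subset_left hνS
    _ = ∫⁻ z in S ×ˢ Set.univ, z.2 T ∂(π.map fun ν ↦ (g ν, ν)) := by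
        rw [lintegral_indicator (hg hS), setLIntegral_map (hS.prod .univ)
          hT'' (by fun_prop)]
        congr 2
        ext; simp
    _ = ∫⁻ x in S, η x T ∂(π.map g) := by
        rw [← hκ, Measure.setLIntegral_compProd hT'' hS .univ]
        simp [hη, Measure.join_apply hT]

/-- Universal property of the hypernormalization (standard measure) of a deterministic
statistical experiment: let `f : Θ → X` be measurable, `p` a probability measure on `Θ`,
`q = p.map f`, `m = p.map (θ ↦ (f θ, θ))`, and let `f̂ = q.map (x ↦ m.condKernel x)` be
the standard measure of `f`. Then every decomposition `π` of `p` (a probability measure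
on `Measure Θ` concentrated on probability measures with `π.join = p`) whose pushforward
along `Measure.map f` is the Dirac decomposition `q.map Measure.dirac` admits a partial
evaluation to `f̂`: there is a probability measure `K` on `Measure (Measure Θ)`,
concentrated on probability measures concentrated on probability measures, with
`K.join = π` and `K.map Measure.join = f̂`. -/
theorem hypernormalization_universal_property
    {Θ X : Type*} [MeasurableSpace Θ] [StandardBorelSpace Θ] [Nonempty Θ]
    [MeasurableSpace X] [StandardBorelSpace X]
    (p : Measure Θ) [IsProbabilityMeasure p]
    (f : Θ → X) (hf : Measurable f)
    (q : Measure X) (hq : q = p.map f)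
    (m : Measure (X × Θ)) [IsFiniteMeasure m]
    (hm : m = p.map (fun θ => (f θ, θ)))
    (π : Measure (Measure Θ)) [IsProbabilityMeasure π]
    (hπconc : π {ν : Measure Θ | ν Set.univ = 1} = 1)
    (hπjoin : π.join = p)
    (hπfine : π.map (Measure.map f) = q.map Measure.dirac) :
    ∃ K : Measure (Measure (Measure Θ)), IsProbabilityMeasure K ∧
      K {Λ : Measure (Measure Θ) |
          Λ Set.univ = 1 ∧ Λ {ν : Measure Θ | ν Set.univ = 1} = 1} = 1 ∧
      K.join = π ∧
      K.map Measure.join = q.map (fun x => m.condKernel x) := by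
  have hX : Nonempty X := ‹Nonempty Θ›.map f
  have hqp : IsProbabilityMeasure q := hq ▸ Measure.isProbabilityMeasure_map hf.aemeasurable
  have hπ : ∀ᵐ ν ∂π, IsProbabilityMeasure ν := by
    simp_rw [isProbabilityMeasure_iff]
    exact (mem_ae_iff_prob_eq_one
      (Measure.measurable_coe MeasurableSet.univ (measurableSet_singleton 1))).mpr hπconc
  obtain ⟨D, hD, hDdirac⟩ := exists_measurable_leftInverse_dirac X
  have hmapf := Measure.measurable_map f hf
  have hg : Measurable fun ν : Measure Θ ↦ D (ν.map f) := hD.comp hmapf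
  have hπg : π.map (fun ν ↦ D (ν.map f)) = q := by
    rw [← Function.comp_def, ← Measure.map_map hD hmapf, hπfine,
      Measure.map_map hD Measure.measurable_dirac]
    simp [Function.comp_def, hDdirac]
  have hfg (S : Set X) (hS : MeasurableSet S) :
      ∀ᵐ ν ∂π, ν (f ⁻¹' S) = ((fun ν ↦ D (ν.map f)) ⁻¹' S).indicator 1 ν := by
    have hmeas : MeasurableSet {μ : Measure X | μ S = (D ⁻¹' S).indicator 1 μ} :=
      measurableSet_eq_fun (Measure.measurable_coe hS) (measurable_one.indicator (hD hS))
    have h : ∀ᵐ μ ∂π.map (Measure.map f), μ S = (D ⁻¹' S).indicator 1 μ := by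
      rw [hπfine, ae_map_iff Measure.measurable_dirac.aemeasurable hmeas]
      refine ae_of_all _ fun x ↦ ?_
      have hmem : Measure.dirac x ∈ D ⁻¹' S ↔ x ∈ S := by rw [Set.mem_preimage, hDdirac]
      by_cases hx : x ∈ S <;> simp only [Measure.dirac_apply' _ hS, Set.indicator, hmem, hx] <;> rfl
    filter_upwards [(ae_map_iff hmapf.aemeasurable hmeas).mp h] with ν hν
    rw [← Measure.map_apply hf hS, hν]
    rfl
  obtain ⟨κ, hκmarkov, hκ, hκπ⟩ := exists_kernel_compProd_eq_map_prodMk π hπ hg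
  let η : ProbabilityTheory.Kernel X Θ :=
    ⟨fun x ↦ (κ x).join, Measure.measurable_join.comp κ.measurable⟩
  have hη : ProbabilityTheory.IsMarkovKernel η := by
    refine ⟨fun x ↦ ⟨?_⟩⟩
    change (κ x).join Set.univ = 1
    rw [Measure.join_apply .univ, lintegral_congr_ae (g := fun _ ↦ 1), lintegral_one, measure_univ]
    filter_upwards [hκ x] with ν hν using hν.measure_univ
  have : IsFiniteMeasure π.join := hπjoin ▸ inferInstance
  have hmη : m = q.compProd η := by
    rw [hm, ← hπjoin, map_join_prodMk_eq_compProd π hπ hf hg hfg κ hκπ η fun _ ↦ rfl, hπg]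
  have hmfst : m.fst = q := by rw [hmη, Measure.fst_compProd]
  refine ⟨q.map κ, Measure.isProbabilityMeasure_map κ.measurable.aemeasurable, ?_, ?_, ?_⟩
  · have hset : MeasurableSet {Λ : Measure (Measure Θ) |
        Λ Set.univ = 1 ∧ Λ {ν : Measure Θ | ν Set.univ = 1} = 1} :=
      (Measure.measurable_coe MeasurableSet.univ (measurableSet_singleton 1)).inter
        (Measure.measurable_coe (Measure.measurable_coe MeasurableSet.univ
          (measurableSet_singleton 1)) (measurableSet_singleton 1))
    rw [Measure.map_apply κ.measurable hset, Set.eq_univ_of_forall (s := κ ⁻¹' _), measure_univ]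
    refine fun x ↦ ⟨measure_univ, ?_⟩
    refine (mem_ae_iff_prob_eq_one
      (Measure.measurable_coe MeasurableSet.univ (measurableSet_singleton 1))).mp ?_
    filter_upwards [hκ x] with ν hν using hν.measure_univ
  · change q.bind κ = π
    rw [← Measure.snd_compProd, ← hπg, hκπ, Measure.snd_map_prodMk hg, Measure.map_id']
  · rw [Measure.map_map Measure.measurable_join κ.measurable]
    refine Measure.map_congr ?_
    have h := ProbabilityTheory.eq_condKernel_of_measure_eq_compProd (ρ := m) η
      (by rw [hmfst]; exact hmη)
    rwa [hmfst] at h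
end
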